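/- Let N ≥ 1, Ω ⊂ ℝ^N a nonempty bounded open set, p > 2, and λ₁ > 0. Let f : ℝ → ℝ be continuous with f(0) = 0 and f(u) > 0 for u > 0, and suppose there are constants α > p, β > 0, γ > 0 with β ≤ (α−p)λ₁/p such that α F(u) ≤ u f(u) + β u^p + γ for all u > 0 (condition (C_p)). Let u₀ be a nonnegative, not identically zero, continuously differentiable function on the closure of Ω with u₀ = 0 on ∂Ω satisfying J_p(0) := −(1/p)∫_Ω ‖∇u₀(x)‖^p dx + ∫_Ω (F(u₀(x)) − γ) dx > 0. Set σ := √(α/2) − 1 and M := (α/(α−2))·(1+√(α/2))·(∫_Ω u₀² dx)² / (2α J_p(0)). Then for every T > 0: if u is continuous on cl(Ω)×[0,T), sufficiently smooth on Ω×(0,T), nonnegative, satisfies ∂_t u(x,t) = div_x(‖∇_x u(x,t)‖^{p−2} ∇_x u(x,t)) + f(u(x,t)) pointwise on Ω×(0,T), u(x,t) = 0 for x ∈ ∂Ω and t ∈ [0,T), u(x,0) = u₀(x), and λ₁ ∫_Ω u(x,t)^p dx ≤ ∫_Ω ‖∇_x u(x,t)‖^p dx for every t ∈ [0,T) (as holds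 when λ₁ is the first Dirichlet eigenvalue of the p-Laplacian on Ω), then T ≤ M/(σ ∫_Ω u₀² dx). In particular the solution blows up at some finite time T* ≤ M/(σ ∫_Ω u₀² dx) in the sense that ∫₀^t ∫_Ω u(x,s)² dx ds → +∞ as t → T*. -/

import Mathlib

open MeasureTheory Real Set

/-- The `p`-Laplacian `div(‖∇w‖^{p-2} ∇w)` of `w` at `x`, computed pointwise. -/
noncomputable def pLaplacian {N : ℕ} (p : ℝ) (w : EuclideanSpace ℝ (Fin N) → ℝ)
    (x : EuclideanSpace ℝ (Fin N)) : ℝ :=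
  ∑ i, EuclideanSpace.proj i
    (fderiv ℝ (fun y => ‖gradient w y‖ ^ (p - 2) • gradient w y) x (EuclideanSpace.single i 1))

open Filter Topology

theorem hasFDerivAt_norm_rpow_smul_zero {E : Type*} [NormedAddCommGroup E] [NormedSpace ℝ E]
    {r : ℝ} (hr : 0 < r) : HasFDerivAt (fun v : E => ‖v‖ ^ r • v) (0 : E →L[ℝ] E) 0 := by
  rw [hasFDerivAt_iff_isLittleO_nhds_zero]
  have h : Tendsto (fun v : E => ‖v‖ ^ r) (𝓝 0) (𝓝 0) := by
    have := ((continuous_norm (E := E)).rpow_const (fun _ => Or.inr hr.le)).tendsto 0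
    simpa [Real.zero_rpow hr.ne'] using this
  have h2 : (fun v : E => ‖v‖ ^ r • v) =o[𝓝 0] (fun v : E => (1 : ℝ) • v) :=
    ((Asymptotics.isLittleO_one_iff ℝ).2 h).smul_isBigO (Asymptotics.isBigO_refl _ _)
  simpa using h2

/-- For `p > 2`, the `p`-Laplacian of a `C²` function vanishes at its critical points. -/
theorem pLaplacian_eq_zero_of_isLocalMax {N : ℕ} {p : ℝ} (hp : 2 < p)
    {w : EuclideanSpace ℝ (Fin N) → ℝ} {x : EuclideanSpace ℝ (Fin N)}
    (hw : ContDiffAt ℝ 2 w x) (hx : IsLocalMax w x) : pLaplacian p w x = 0 := by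
  have hgrad : gradient w x = 0 := by simp [gradient, hx.fderiv_eq_zero]
  have hdiff : DifferentiableAt ℝ (gradient w) x := by
    have h1 : DifferentiableAt ℝ (fderiv ℝ w) x :=
      (hw.fderiv_right (m := 1) (by norm_num)).differentiableAt (by norm_num)
    exact ((InnerProductSpace.toDual ℝ
      (EuclideanSpace ℝ (Fin N))).symm.toContinuousLinearEquiv.differentiableAt
      (x := fderiv ℝ w x)).comp x h1
  have h0 : HasFDerivAt (fun v : EuclideanSpace ℝ (Fin N) => ‖v‖ ^ (p - 2) • v)
      (0 : EuclideanSpace ℝ (Fin N) →L[ℝ] EuclideanSpace ℝ (Fin N)) (gradient w x) := by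
    rw [hgrad]
    exact hasFDerivAt_norm_rpow_smul_zero (by linarith)
  have h := (h0.comp x hdiff.hasFDerivAt).fderiv
  have h' : fderiv ℝ (fun y => ‖gradient w y‖ ^ (p - 2) • gradient w y) x = 0 := by
    rw [ContinuousLinearMap.zero_comp] at h
    exact h
  simp [pLaplacian, h']

theorem exists_continuousOn_max {X : Type*} [TopologicalSpace X] {K : Set X} (hK : IsCompact K)
    (hne : K.Nonempty) {I : Set ℝ} {u : X → ℝ → ℝ}
    (hu : ContinuousOn (fun q : X × ℝ => u q.1 q.2) (K ×ˢ I)) :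
    ∃ m : ℝ → ℝ, ContinuousOn m I ∧
      ∀ t ∈ I, ∃ x ∈ K, u x t = m t ∧ ∀ y ∈ K, u y t ≤ m t := by
  have : CompactSpace K := isCompact_iff_compactSpace.1 hK
  refine ⟨fun t => sSup ((fun y : K => u y t) '' univ), ?_, ?_⟩
  · rw [continuousOn_iff_continuous_domRestrict]
    refine isCompact_univ.continuous_sSup (f := fun (t : I) (y : K) => u y t) ?_
    exact hu.comp_continuous (f := fun q : I × K => ((q.2 : X), (q.1 : ℝ))) (by fun_prop)
      (fun q => ⟨q.2.2, q.1.2⟩)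
  · intro t ht
    have hc : ContinuousOn (fun y => u y t) K :=
      hu.comp (f := fun y => (y, t)) (by fun_prop) (fun y hy => ⟨hy, ht⟩)
    obtain ⟨x, hx, hmax⟩ := hK.exists_isMaxOn hne hc
    have hg : IsGreatest ((fun y : K => u y t) '' univ) (u x t) := by
      refine ⟨⟨⟨x, hx⟩, trivial, rfl⟩, ?_⟩
      rintro _ ⟨y, -, rfl⟩
      exact hmax y.2
    exact ⟨x, hx, hg.csSup_eq.symm, fun y hy => (hmax hy).trans hg.csSup_eq.ge⟩

/-- A continuous function that is touched from above, at each time, by a function of derivative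
at most `C`, grows at most linearly with slope `C`. -/
theorem le_add_mul_of_touching_above {φ : ℝ → ℝ} {T C : ℝ} (hφ : ContinuousOn φ (Ico 0 T))
    (h : ∀ t ∈ Ioo 0 T, ∃ (ψ : ℝ → ℝ) (d : ℝ), ψ t = φ t ∧ (∀ᶠ z in 𝓝[>] t, φ z ≤ ψ z) ∧
      HasDerivAt ψ d t ∧ d ≤ C) {t : ℝ} (ht : t ∈ Ico 0 T) : φ t ≤ φ 0 + C * t := by
  rcases ht.1.eq_or_lt with rfl | ht0
  · simp
  have key : ∀ s ∈ Ioo 0 t, φ t ≤ φ s + C * (t - s) := by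
    intro s hs
    refine image_le_of_liminf_slope_right_le_deriv_boundary (f := φ) (a := s) (b := t)
      (B := fun z => φ s + C * (z - s)) (B' := fun _ => C)
      (hφ.mono fun z hz => ⟨hs.1.le.trans hz.1, hz.2.trans_lt ht.2⟩) (by simp)
      (by fun_prop) ?_ ?_ ⟨hs.2.le, le_rfl⟩
    · intro z hz
      have := (((hasDerivAt_id z).sub_const s).const_mul C).const_add (φ s)
      simpa using this.hasDerivWithinAt
    · intro z hz r hr
      obtain ⟨ψ, d, hψz, hle, hd, hdC⟩ := h z ⟨hs.1.trans_le hz.1, hz.2.trans ht.2⟩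
      have hlt : ∀ᶠ y in 𝓝[>] z, slope ψ z y < r :=
        ((hasDerivAt_iff_tendsto_slope.1 hd).mono_left
          (nhdsWithin_mono _ fun y hy => ne_of_gt hy)).eventually (gt_mem_nhds (hdC.trans_lt hr))
      refine Eventually.frequently ?_
      filter_upwards [hlt, hle, self_mem_nhdsWithin] with y h1 h2 h3
      refine lt_of_le_of_lt ?_ h1
      have h3 : 0 < y - z := sub_pos.2 h3
      rw [slope_def_field, slope_def_field, hψz]
      gcongr
  have hlim : Tendsto (fun s => φ s + C * (t - s)) (𝓝[Ioo 0 t] 0) (𝓝 (φ 0 + C * (t - 0))) := by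
    have h1 : Tendsto φ (𝓝[Ioo 0 t] 0) (𝓝 (φ 0)) :=
      (hφ 0 ⟨le_rfl, ht0.trans ht.2⟩).mono_left
        (nhdsWithin_mono _ fun s hs => ⟨hs.1.le, hs.2.trans ht.2⟩)
    have h2 : Tendsto (fun s : ℝ => C * (t - s)) (𝓝[Ioo 0 t] 0) (𝓝 (C * (t - 0))) :=
      (Continuous.tendsto (by fun_prop) 0).mono_left nhdsWithin_le_nhds
    exact h1.add h2
  have : (𝓝[Ioo 0 t] (0 : ℝ)).NeBot := by
    rw [nhdsWithin_Ioo_eq_nhdsGT ht0]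
    infer_instance
  have := ge_of_tendsto hlim (eventually_mem_nhdsWithin.mono key)
  simpa using this

/-- If `α G ≤ y G'` then `y ↦ G y / y ^ α` is nondecreasing on `(0, ∞)`. -/
theorem le_mul_div_rpow_of_mul_le_deriv {G G' : ℝ → ℝ} {α : ℝ}
    (hG : ∀ y, 0 < y → HasDerivAt G (G' y) y) (hle : ∀ y, 0 < y → α * G y ≤ y * G' y)
    {y z : ℝ} (hy : 0 < y) (hyz : y ≤ z) : G y ≤ G z * (y / z) ^ α := by
  have hd : ∀ x, 0 < x → HasDerivAt (fun x => G x * x ^ (-α))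
      (G' x * x ^ (-α) + G x * (-α * x ^ (-α - 1))) x := fun x hx =>
    (hG x hx).mul (Real.hasDerivAt_rpow_const (Or.inl hx.ne'))
  have hmono : MonotoneOn (fun x => G x * x ^ (-α)) (Ioi 0) := by
    refine monotoneOn_of_deriv_nonneg (convex_Ioi 0)
      (fun x hx => (hd x hx).continuousAt.continuousWithinAt)
      (fun x hx => (hd x (interior_subset hx)).differentiableAt.differentiableWithinAt) ?_
    intro x hx
    have hx : 0 < x := interior_subset hx
    rw [(hd x hx).deriv, Real.rpow_sub_one hx.ne']
    have : G' x * x ^ (-α) + G x * (-α * (x ^ (-α) / x))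
        = x ^ (-α) / x * (x * G' x - α * G x) := by
      field_simp
      ring
    rw [this]
    exact mul_nonneg (by positivity) (sub_nonneg.2 (hle x hx))
  have hz : 0 < z := hy.trans_le hyz
  have h := hmono hy hz hyz
  simp only [Real.rpow_neg hy.le, Real.rpow_neg hz.le] at h
  rw [Real.div_rpow hy.le hz.le]
  have hyα : 0 < y ^ α := Real.rpow_pos_of_pos hy α
  calc G y = G y * (y ^ α)⁻¹ * y ^ α := by field_simp
    _ ≤ G z * (z ^ α)⁻¹ * y ^ α := by gcongr
    _ = G z * (y ^ α / z ^ α) := by ring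

/-- The maximum of a solution of `u_t = Δ_p u + f(u)` satisfies `m' ≥ f(m)`; if `f` grows at least
like `c y^{α-1}` past the initial maximum, this bounds the lifetime of the solution. -/
theorem lifetime_le_of_rpow_le {N : ℕ} {p : ℝ} (hp : 2 < p)
    {Ω : Set (EuclideanSpace ℝ (Fin N))} (hΩopen : IsOpen Ω) {f : ℝ → ℝ}
    (hfpos : ∀ y : ℝ, 0 < y → 0 < f y) {T α c : ℝ} (hα : 2 < α) (hc : 0 < c)
    {u : EuclideanSpace ℝ (Fin N) → ℝ → ℝ} {m : ℝ → ℝ} (hm : ContinuousOn m (Ico 0 T))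
    (hmax : ∀ t ∈ Ico 0 T, ∃ x ∈ closure Ω, u x t = m t ∧ ∀ y ∈ closure Ω, u y t ≤ m t)
    (hspace : ∀ t ∈ Ioo 0 T, ContDiffOn ℝ 2 (fun x => u x t) Ω)
    (htime : ∀ x ∈ Ω, ContDiffOn ℝ 1 (u x) (Ioo 0 T))
    (hnonneg : ∀ x ∈ closure Ω, ∀ t ∈ Ico 0 T, 0 ≤ u x t)
    (hpde : ∀ x ∈ Ω, ∀ t ∈ Ioo 0 T,
      deriv (u x) t = pLaplacian p (fun y => u y t) x + f (u x t))
    (hbdry : ∀ x ∈ frontier Ω, ∀ t ∈ Ico 0 T, u x t = 0)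
    (hm0 : 0 < m 0) (hf : ∀ y, m 0 ≤ y → c * y ^ (α - 1) ≤ f y) :
    T ≤ m 0 ^ (2 - α) / ((α - 2) * c) := by
  have hmnn : ∀ t ∈ Ico 0 T, 0 ≤ m t := by
    intro t ht
    obtain ⟨x, hx, hxm, -⟩ := hmax t ht
    exact hxm ▸ hnonneg x hx t ht
  have htouch : ∀ t ∈ Ioo 0 T, 0 < m t → ∃ v : ℝ → ℝ, v t = m t ∧
      (∀ᶠ z in 𝓝[>] t, v z ≤ m z) ∧ HasDerivAt v (f (m t)) t := by
    intro t ht hpos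
    have htI : t ∈ Ico 0 T := ⟨ht.1.le, ht.2⟩
    obtain ⟨x, hx, hxm, hxmax⟩ := hmax t htI
    have hxΩ : x ∈ Ω := by
      by_contra hn
      have := hbdry x (hΩopen.frontier_eq ▸ ⟨hx, hn⟩) t htI
      linarith
    refine ⟨u x, hxm, ?_, ?_⟩
    · filter_upwards [Ioo_mem_nhdsGT ht.2] with z hz
      obtain ⟨-, -, -, h⟩ := hmax z ⟨ht.1.le.trans hz.1.le, hz.2⟩
      exact h x hx
    · have hloc : IsLocalMax (fun y => u y t) x := by
        filter_upwards [hΩopen.mem_nhds hxΩ] with y hy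
        exact (hxmax y (subset_closure hy)).trans hxm.ge
      have h0 := pLaplacian_eq_zero_of_isLocalMax hp
        ((hspace t ht).contDiffAt (hΩopen.mem_nhds hxΩ)) hloc
      have hd := (((htime x hxΩ).contDiffAt (isOpen_Ioo.mem_nhds ht)).differentiableAt
        (by norm_num)).hasDerivAt
      rwa [hpde x hxΩ t ht, h0, zero_add, hxm] at hd
  have hge : ∀ t ∈ Ico 0 T, m 0 ≤ m t := by
    intro t ht
    have := le_add_mul_of_touching_above (φ := fun t => -m t) (C := 0) hm.neg ?_ ht
    · simpa using this
    intro s hs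
    rcases (hmnn s ⟨hs.1.le, hs.2⟩).eq_or_lt with h0 | hpos
    · refine ⟨fun _ => 0, 0, by simp [← h0], ?_, hasDerivAt_const _ _, le_rfl⟩
      filter_upwards [Ioo_mem_nhdsGT hs.2] with z hz
      simpa using hmnn z ⟨hs.1.le.trans hz.1.le, hz.2⟩
    · obtain ⟨v, hv, hle, hd⟩ := htouch s hs hpos
      refine ⟨fun z => -v z, _, by simp [hv], ?_, hd.neg, by simpa using (hfpos _ hpos).le⟩
      filter_upwards [hle] with z hz
      simpa using hz
  have hmpos : ∀ t ∈ Ico 0 T, 0 < m t := fun t ht => hm0.trans_le (hge t ht)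
  have hpow : ∀ t ∈ Ico 0 T, m t ^ (2 - α) ≤ m 0 ^ (2 - α) + -((α - 2) * c) * t := by
    intro t ht
    refine le_add_mul_of_touching_above (φ := fun t => m t ^ (2 - α))
      (hm.rpow_const fun t ht => Or.inl (hmpos t ht).ne') ?_ ht
    intro s hs
    have hsI : s ∈ Ico 0 T := ⟨hs.1.le, hs.2⟩
    have hpos := hmpos s hsI
    obtain ⟨v, hv, hle, hd⟩ := htouch s hs hpos
    refine ⟨fun z => v z ^ (2 - α), _, by simp [hv], ?_,
      hd.rpow_const (Or.inl (hv ▸ hpos.ne')), ?_⟩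
    · have hvpos : ∀ᶠ z in 𝓝[>] s, 0 < v z :=
        nhdsWithin_le_nhds (hd.continuousAt.eventually (lt_mem_nhds (hv ▸ hpos)))
      filter_upwards [hle, hvpos] with z hz hz0
      exact Real.rpow_le_rpow_of_nonpos hz0 hz (by linarith)
    · rw [hv]
      have h1 : m s ^ (α - 1) * m s ^ (2 - α - 1) = 1 := by
        rw [← Real.rpow_add hpos]
        ring_nf
        exact Real.rpow_zero _
      have h2 : c ≤ f (m s) * m s ^ (2 - α - 1) := by
        calc c = c * (m s ^ (α - 1) * m s ^ (2 - α - 1)) := by rw [h1, mul_one]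
          _ = c * m s ^ (α - 1) * m s ^ (2 - α - 1) := by ring
          _ ≤ _ := by
            gcongr
            exact hf _ (hge s hsI)
      nlinarith
  have hA : 0 < (α - 2) * c := mul_pos (by linarith) hc
  refine le_of_forall_lt fun t ht => ?_
  rcases lt_or_ge t 0 with h0 | h0
  · exact h0.trans (by positivity)
  · rw [lt_div_iff₀ hA]
    have h1 := hpow t ⟨h0, ht⟩
    have h2 := Real.rpow_pos_of_pos (hmpos t ⟨h0, ht⟩) (2 - α)
    linarith

/-- Blow-up (with explicit bound on the blow-up time) for nonnegative solutions of
`u_t = Δ_p u + f(u)` (`p > 2`) with Dirichlet boundary conditions, under the condition `(C_p)`: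
`α F(u) ≤ u f(u) + β u^p + γ` with `0 < β ≤ (α-p)λ₁/p`, and initial energy `J_p(0) > 0`. -/
theorem blowup_pLaplacian_condition_Cp
    {N : ℕ} (hN : 1 ≤ N) (p : ℝ) (hp : 2 < p)
    (Ω : Set (EuclideanSpace ℝ (Fin N)))
    (hΩopen : IsOpen Ω) (hΩbdd : Bornology.IsBounded Ω) (hΩne : Ω.Nonempty)
    (lam1 : ℝ) (hlam1 : 0 < lam1)
    (f : ℝ → ℝ) (hfcont : Continuous f) (hf0 : f 0 = 0)
    (hfpos : ∀ u : ℝ, 0 < u → 0 < f u)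
    (F : ℝ → ℝ) (hF : ∀ u : ℝ, F u = ∫ s in (0:ℝ)..u, f s)
    (α β γ : ℝ) (hα : p < α) (hβ : 0 < β) (hγ : 0 < γ)
    (hβle : β ≤ (α - p) * lam1 / p)
    (hCp : ∀ u : ℝ, 0 < u → α * F u ≤ u * f u + β * u ^ p + γ)
    (u₀ : EuclideanSpace ℝ (Fin N) → ℝ)
    (hu₀C1 : ContDiffOn ℝ 1 u₀ (closure Ω))
    (hu₀nonneg : ∀ x ∈ closure Ω, 0 ≤ u₀ x)
    (hu₀netriv : ∃ x ∈ closure Ω, u₀ x ≠ 0)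
    (hu₀bdry : ∀ x ∈ frontier Ω, u₀ x = 0)
    (J0 : ℝ)
    (hJ0def : J0 = -(1/p) * (∫ x in Ω, ‖gradient u₀ x‖ ^ p)
      + ∫ x in Ω, (F (u₀ x) - γ))
    (hJ0pos : 0 < J0)
    (σ M : ℝ)
    (hσdef : σ = Real.sqrt (α / 2) - 1)
    (hMdef : M = (α / (α - 2)) * (1 + Real.sqrt (α / 2))
      * (∫ x in Ω, (u₀ x) ^ 2) ^ 2 / (2 * α * J0)) :
    ∀ T : ℝ, 0 < T →
    ∀ u : EuclideanSpace ℝ (Fin N) → ℝ → ℝ,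
      -- continuity on cl(Ω) × [0,T)
      ContinuousOn (fun q : EuclideanSpace ℝ (Fin N) × ℝ => u q.1 q.2)
        (closure Ω ×ˢ Set.Ico 0 T) →
      -- sufficiently smooth in space on Ω × (0,T)
      (∀ t ∈ Set.Ioo (0:ℝ) T, ContDiffOn ℝ 2 (fun x => u x t) Ω) →
      -- sufficiently smooth in time on Ω × (0,T)
      (∀ x ∈ Ω, ContDiffOn ℝ 1 (u x) (Set.Ioo (0:ℝ) T)) →
      -- nonnegativity
      (∀ x ∈ closure Ω, ∀ t ∈ Set.Ico (0:ℝ) T, 0 ≤ u x t) →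
      -- the PDE on Ω × (0,T)
      (∀ x ∈ Ω, ∀ t ∈ Set.Ioo (0:ℝ) T,
        deriv (u x) t = pLaplacian p (fun y => u y t) x + f (u x t)) →
      -- Dirichlet boundary condition
      (∀ x ∈ frontier Ω, ∀ t ∈ Set.Ico (0:ℝ) T, u x t = 0) →
      -- initial condition
      (∀ x ∈ closure Ω, u x 0 = u₀ x) →
      -- Poincaré inequality with constant λ₁ for the solution
      (∀ t ∈ Set.Ico (0:ℝ) T,
        lam1 * ∫ x in Ω, (u x t) ^ p ≤ ∫ x in Ω, ‖gradient (fun y => u y t) x‖ ^ p) →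
      T ≤ M / (σ * ∫ x in Ω, (u₀ x) ^ 2) := by
  intro T hT u hucont hspace htime hnonneg hpde hbdry hinit hpoinc
  have hK : IsCompact (closure Ω) := hΩbdd.isCompact_closure
  obtain ⟨m, hm, hmax⟩ := exists_continuousOn_max hK hΩne.closure hucont
  have h0T : (0 : ℝ) ∈ Ico 0 T := ⟨le_rfl, hT⟩
  have hα2 : 2 < α := hp.trans hα
  have hu₀m : ∀ x ∈ closure Ω, u₀ x ≤ m 0 := by
    obtain ⟨-, -, -, h⟩ := hmax 0 h0T
    exact fun x hx => hinit x hx ▸ h x hx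
  have hm0 : 0 < m 0 := by
    obtain ⟨x, hx, hne⟩ := hu₀netriv
    exact ((hu₀nonneg x hx).lt_of_ne' hne).trans_le (hu₀m x hx)
  have hFd : ∀ y, HasDerivAt F (f y) y := by
    intro y
    rw [funext hF]
    exact intervalIntegral.integral_hasDerivAt_right (hfcont.intervalIntegrable _ _)
      hfcont.stronglyMeasurable.stronglyMeasurableAtFilter hfcont.continuousAt
  have hFc : Continuous F := continuous_iff_continuousAt.2 fun y => (hFd y).continuousAt
  have hp0 : 0 < p := by linarith
  set G : ℝ → ℝ := fun y => F y - γ - lam1 / p * y ^ p with hGdef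
  have hGd : ∀ y, 0 < y → HasDerivAt G (f y - lam1 * y ^ (p - 1)) y := by
    intro y hy
    have h := ((hFd y).sub_const γ).sub
      ((Real.hasDerivAt_rpow_const (p := p) (Or.inl hy.ne')).const_mul (lam1 / p))
    rwa [← mul_assoc, div_mul_cancel₀ _ hp0.ne'] at h
  have hGle : ∀ y, 0 < y → α * G y ≤ y * (f y - lam1 * y ^ (p - 1)) := by
    intro y hy
    have h1 : y * y ^ (p - 1) = y ^ p := by
      rw [Real.rpow_sub_one hy.ne']
      field_simp
    have h2 : β * y ^ p ≤ (α - p) * lam1 / p * y ^ p :=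
      mul_le_mul_of_nonneg_right hβle (by positivity)
    have h3 : (α - p) * lam1 / p * y ^ p = α * (lam1 / p * y ^ p) - lam1 * y ^ p := by
      rw [sub_mul, sub_div, mul_div_cancel_left₀ _ hp0.ne']
      ring
    have h4 := hCp y hy
    have h5 : γ ≤ α * γ := by nlinarith
    have h6 : y * (f y - lam1 * y ^ (p - 1)) = y * f y - lam1 * y ^ p := by
      rw [← h1]
      ring
    rw [h6]
    simp only [hGdef]
    linarith
  have hG0 : G 0 = -γ := by simp [hGdef, hF, Real.zero_rpow hp0.ne']
  have hGle0 : ∀ y, 0 ≤ y → y ≤ m 0 → G y ≤ G (m 0) * (y / m 0) ^ α := by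
    intro y hy hym
    rcases hy.eq_or_lt with rfl | hy
    · rw [hG0, zero_div, Real.zero_rpow (by linarith), mul_zero]
      linarith
    · exact le_mul_div_rpow_of_mul_le_deriv hGd hGle hy hym
  have hu₀c : ContinuousOn u₀ (closure Ω) := hu₀C1.continuousOn
  have hint : ∀ {g : ℝ → ℝ}, Continuous g → IntegrableOn (fun x => g (u₀ x)) Ω := fun hg =>
    ((hg.comp_continuousOn hu₀c).integrableOn_compact hK).mono_set subset_closure
  have hpowc : Continuous fun y : ℝ => y ^ p := continuous_id.rpow_const fun _ => Or.inr hp0.le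
  have hJ : J0 ≤ ∫ x in Ω, G (u₀ x) := by
    have h1 := hpoinc 0 h0T
    have h2 : ∫ x in Ω, u x 0 ^ p = ∫ x in Ω, u₀ x ^ p :=
      setIntegral_congr_fun hΩopen.measurableSet fun x hx => by
        simp only [hinit x (subset_closure hx)]
    have h3 : ∫ x in Ω, ‖gradient (fun y => u y 0) x‖ ^ p = ∫ x in Ω, ‖gradient u₀ x‖ ^ p :=
      setIntegral_congr_fun hΩopen.measurableSet fun x hx => by
        have h : (fun y => u y 0) =ᶠ[𝓝 x] u₀ := by
          filter_upwards [hΩopen.mem_nhds hx] with y hy using hinit y (subset_closure hy)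
        simp only [gradient, h.fderiv_eq]
    rw [h2, h3] at h1
    have h4 : ∫ x in Ω, G (u₀ x)
        = (∫ x in Ω, (F (u₀ x) - γ)) - lam1 / p * ∫ x in Ω, u₀ x ^ p := by
      rw [← integral_const_mul]
      exact integral_sub (hint (g := fun y => F y - γ) (by fun_prop))
        (hint (g := fun y => lam1 / p * y ^ p) (by fun_prop))
    have h5 : lam1 / p * ∫ x in Ω, u₀ x ^ p ≤ 1 / p * ∫ x in Ω, ‖gradient u₀ x‖ ^ p := by
      calc _ = 1 / p * (lam1 * ∫ x in Ω, u₀ x ^ p) := by ring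
        _ ≤ _ := by gcongr
    rw [h4, hJ0def]
    linarith
  have hGm : 0 < G (m 0) := by
    by_contra! hn
    have : ∫ x in Ω, G (u₀ x) ≤ 0 := by
      refine setIntegral_nonpos hΩopen.measurableSet fun x hx => ?_
      have hx := subset_closure hx
      refine (hGle0 _ (hu₀nonneg x hx) (hu₀m x hx)).trans ?_
      exact mul_nonpos_of_nonpos_of_nonneg hn
        (Real.rpow_nonneg (div_nonneg (hu₀nonneg x hx) hm0.le) _)
    linarith
  set S := ∫ x in Ω, u₀ x ^ 2 with hS
  have hJS : J0 ≤ G (m 0) / m 0 ^ 2 * S := by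
    refine hJ.trans ?_
    rw [hS, ← integral_const_mul]
    refine setIntegral_mono_on (hint (g := G) (by fun_prop))
      (hint (g := fun y => G (m 0) / m 0 ^ 2 * y ^ 2) (by fun_prop)) hΩopen.measurableSet ?_
    intro x hx
    have hx := subset_closure hx
    have hnn := div_nonneg (hu₀nonneg x hx) hm0.le
    calc G (u₀ x) ≤ G (m 0) * (u₀ x / m 0) ^ α := hGle0 _ (hu₀nonneg x hx) (hu₀m x hx)
      _ ≤ G (m 0) * (u₀ x / m 0) ^ (2 : ℝ) := by
        refine mul_le_mul_of_nonneg_left ?_ hGm.le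
        exact Real.rpow_le_rpow_of_exponent_ge_of_imp hnn ((div_le_one hm0).2 (hu₀m x hx))
          hα2.le (by intros; linarith)
      _ = G (m 0) / m 0 ^ 2 * u₀ x ^ 2 := by
        rw [Real.rpow_two]
        ring
  have hSpos : 0 < S := pos_of_mul_pos_right (hJ0pos.trans_le hJS) (by positivity)
  have hmα : 0 < m 0 ^ α := Real.rpow_pos_of_pos hm0 α
  have hlife : T ≤ m 0 ^ (2 - α) / ((α - 2) * (α * G (m 0) / m 0 ^ α)) := by
    refine lifetime_le_of_rpow_le hp hΩopen hfpos hα2 (by positivity) hm hmax hspace htime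
      hnonneg hpde hbdry hm0 fun y hy => ?_
    have hy0 : 0 < y := hm0.trans_le hy
    have h1 := le_mul_div_rpow_of_mul_le_deriv hGd hGle hm0 hy
    have h2 := hGle y hy0
    have hyα : 0 < y ^ α := Real.rpow_pos_of_pos hy0 α
    have h3 : G (m 0) / m 0 ^ α * y ^ α ≤ G y := by
      rw [Real.div_rpow hm0.le hy0.le] at h1
      calc _ ≤ (G y * (m 0 ^ α / y ^ α)) / m 0 ^ α * y ^ α := by gcongr
        _ = G y := by field_simp
    have h4 : 0 ≤ lam1 * y ^ (p - 1) := by positivity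
    rw [Real.rpow_sub_one hy0.ne']
    have h5 : α * G y ≤ y * f y := h2.trans (by gcongr; linarith)
    calc _ = α * (G (m 0) / m 0 ^ α * y ^ α) / y := by ring
      _ ≤ α * G y / y := by gcongr
      _ ≤ f y := by
        rw [div_le_iff₀ hy0]
        linarith
  have hTle : T ≤ S / (α * (α - 2) * J0) := by
    have hα2' : 0 < α - 2 := by linarith
    refine hlife.trans ?_
    rw [Real.rpow_sub hm0, Real.rpow_two]
    rw [div_mul_eq_mul_div, le_div_iff₀ (by positivity)] at hJS
    calc _ = m 0 ^ 2 / (α * (α - 2) * G (m 0)) := by field_simp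
      _ ≤ _ := by
        rw [div_le_div_iff₀ (by positivity) (by positivity)]
        calc _ = α * (α - 2) * (J0 * m 0 ^ 2) := by ring
          _ ≤ α * (α - 2) * (G (m 0) * S) := by gcongr
          _ = _ := by ring
  refine hTle.trans ?_
  have hq : 1 < √(α / 2) := by
    rw [Real.lt_sqrt zero_le_one]
    linarith
  have hα2' : 0 < α - 2 := by linarith
  have hσ : 0 < σ := by linarith
  rw [hMdef, show 1 + √(α / 2) = σ + 2 by linarith]
  have : α / (α - 2) * (σ + 2) * S ^ 2 / (2 * α * J0) / (σ * S)
      = (σ + 2) * S / (2 * (α - 2) * J0 * σ) := by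
    field_simp
  rw [this, div_le_div_iff₀ (by positivity) (by positivity)]
  have h1 : 2 * σ ≤ (σ + 2) * α := by nlinarith
  have h2 := mul_le_mul_of_nonneg_left h1 (show 0 ≤ S * (α - 2) * J0 by positivity)
  linarith
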